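/- arXiv:1807.01500 — 2 statements merged into one kernel-verified Lean document; each statement's English description precedes it below -/
import Mathlib

section
/- For every integer L ≥ 3, the subset of the braid group B_7 consisting of all products of rotated factor lists, namely { (F(a,b,c).rotate i).prod : a, b, c ≥ 0, a + b + c = L − 3, 0 ≤ i < L }, has at least L·(L−1)·(L−2)/2 elements. -/
/-- The Artin relations for the braid group on `n + 1` strands (with `n` generators
`σ_1, …, σ_n`, here indexed by `Fin n` via `σ_{i+1} ↔ i`). -/
def braidRels (n : ℕ) : Set (FreeGroup (Fin n)) :=
  { r | ∃ i j : Fin n,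
      ((i : ℕ) + 1 = (j : ℕ) ∧
        r = FreeGroup.of i * FreeGroup.of j * FreeGroup.of i *
            (FreeGroup.of j * FreeGroup.of i * FreeGroup.of j)⁻¹) ∨
      ((i : ℕ) + 2 ≤ (j : ℕ) ∧
        r = FreeGroup.of i * FreeGroup.of j * (FreeGroup.of j * FreeGroup.of i)⁻¹) }

/-- The braid group `B_7`, presented with generators `σ_1, …, σ_6` and the Artin
relations. -/
abbrev B7 : Type := PresentedGroup (braidRels 6)

/-- The Artin generator `σ_{i+1}` of `B_7` (so `s 0 = σ_1`, …, `s 5 = σ_6`). -/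
def s (i : Fin 6) : B7 := PresentedGroup.of i

/-- The list of `L = 3 + a + b + c` Garside factors
`[σ2σ1σ4σ6] ++ (a copies of σ1σ4σ6) ++ [σ1σ4σ3σ5σ6σ5] ++ (b copies of σ1σ3σ5) ++
[σ5σ4σ3σ2σ1σ6] ++ (c copies of σ2σ4σ6)` in `B_7`. -/
def F (a b c : ℕ) : List B7 :=
  [s 1 * s 0 * s 3 * s 5] ++ List.replicate a (s 0 * s 3 * s 5) ++
    [s 0 * s 3 * s 2 * s 4 * s 5 * s 4] ++ List.replicate b (s 0 * s 2 * s 4) ++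
    [s 4 * s 3 * s 2 * s 1 * s 0 * s 5] ++ List.replicate c (s 1 * s 3 * s 5)

open Matrix in
/-- tactic-free abbreviation for the matrix ring -/
abbrev Mt : Type := Matrix (Fin 6) (Fin 6) ℤ

def gm (e : ℤ) (i : Fin 6) : Mt := fun r c =>
  if r = c then 1 else if r = i then
    (if (c : ℕ) + 1 = (i : ℕ) then -e else if (c : ℕ) = (i : ℕ) + 1 then e else 0) else 0

def gu (i : Fin 6) : Mtˣ :=
  ⟨gm 1 i, gm (-1) i, by revert i; decide, by revert i; decide⟩

theorem gu_braid : ∀ i j : Fin 6, (i : ℕ) + 1 = (j : ℕ) →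
    gm 1 i * gm 1 j * gm 1 i = gm 1 j * gm 1 i * gm 1 j := by decide

theorem gu_comm : ∀ i j : Fin 6, (i : ℕ) + 2 ≤ (j : ℕ) →
    gm 1 i * gm 1 j = gm 1 j * gm 1 i := by decide

theorem gu_rels : ∀ r ∈ braidRels 6, FreeGroup.lift gu r = 1 := by
  rintro r ⟨i, j, ⟨h, rfl⟩ | ⟨h, rfl⟩⟩
  · simp only [map_mul, map_inv, FreeGroup.lift_apply_of]
    rw [mul_inv_eq_one]
    exact Units.ext (gu_braid i j h)
  · simp only [map_mul, map_inv, FreeGroup.lift_apply_of]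
    rw [mul_inv_eq_one]
    exact Units.ext (gu_comm i j h)

def psi : B7 →* Mt := (Units.coeHom Mt).comp (PresentedGroup.toGroup gu_rels)

theorem psi_s (i : Fin 6) : psi (s i) = gm 1 i := by
  show ((PresentedGroup.toGroup gu_rels (PresentedGroup.of i) : Mtˣ) : Mt) = _
  rw [PresentedGroup.toGroup.of]; rfl

def mA : Mt :=
  !![1, 1, 0, 0, 0, 0; -1, 0, 1, 0, 0, 0; 0, 0, 1, 0, 0, 0; 0, 0, -1, 1, 1, 0; 0, 0, 0, 0, 1, 0; 0, 0, 0, 0, -1, 1]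

def mB : Mt :=
  !![1, 1, 0, 0, 0, 0; 0, 1, 0, 0, 0, 0; 0, -1, 1, 1, 0, 0; 0, 1, -1, -1, 0, 1; 0, 0, 0, -1, 0, 1; 0, 0, 0, 1, -1, 0]

def mC : Mt :=
  !![1, 1, 0, 0, 0, 0; -1, 0, 1, 0, 0, 0; 1, 0, 0, 1, 0, 0; -1, 0, 0, 0, 1, 0; 1, 0, 0, 0, -1, 1; 0, 0, 0, 0, -1, 1]

def mX (k : ℤ) : Mt :=
  !![1, k, 0, 0, 0, 0; 0, 1, 0, 0, 0, 0; 0, 0, 1, 0, 0, 0; 0, 0, -k, 1, k, 0; 0, 0, 0, 0, 1, 0; 0, 0, 0, 0, -k, 1]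

def mY (k : ℤ) : Mt :=
  !![1, k, 0, 0, 0, 0; 0, 1, 0, 0, 0, 0; 0, -k, 1, k, 0, 0; 0, 0, 0, 1, 0, 0; 0, 0, 0, -k, 1, k; 0, 0, 0, 0, 0, 1]

def mZ (k : ℤ) : Mt :=
  !![1, 0, 0, 0, 0, 0; -k, 1, k, 0, 0, 0; 0, 0, 1, 0, 0, 0; 0, 0, -k, 1, k, 0; 0, 0, 0, 0, 1, 0; 0, 0, 0, 0, -k, 1]

def wA : B7 := s 1 * s 0 * s 3 * s 5

def wB : B7 := s 0 * s 3 * s 2 * s 4 * s 5 * s 4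

def wC : B7 := s 4 * s 3 * s 2 * s 1 * s 0 * s 5

def wX : B7 := s 0 * s 3 * s 5

def wY : B7 := s 0 * s 2 * s 4

def wZ : B7 := s 1 * s 3 * s 5

theorem psi_wA : psi wA = mA := by
  simp only [wA, map_mul, psi_s]
  decide

theorem psi_wB : psi wB = mB := by
  simp only [wB, map_mul, psi_s]
  decide

theorem psi_wC : psi wC = mC := by
  simp only [wC, map_mul, psi_s]
  decide

theorem psi_wX : psi wX = mX 1 := by
  simp only [wX, map_mul, psi_s]
  decide

theorem psi_wY : psi wY = mY 1 := by
  simp only [wY, map_mul, psi_s]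
  decide

theorem psi_wZ : psi wZ = mZ 1 := by
  simp only [wZ, map_mul, psi_s]
  decide

theorem mX_zero : mX 0 = 1 := by decide

theorem mX_succ (k : ℤ) : mX k * mX 1 = mX (k + 1) := by
  ext i j
  fin_cases i <;> fin_cases j <;>
    simp [mX, Matrix.mul_apply, Fin.sum_univ_succ] <;> ring

theorem psi_wX_pow (k : ℕ) : psi (wX ^ k) = mX k := by
  induction k with
  | zero => simp [mX_zero]
  | succ k ih => rw [pow_succ, map_mul, ih, psi_wX, mX_succ]; push_cast; rfl

theorem mY_zero : mY 0 = 1 := by decide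

theorem mY_succ (k : ℤ) : mY k * mY 1 = mY (k + 1) := by
  ext i j
  fin_cases i <;> fin_cases j <;>
    simp [mY, Matrix.mul_apply, Fin.sum_univ_succ] <;> ring

theorem psi_wY_pow (k : ℕ) : psi (wY ^ k) = mY k := by
  induction k with
  | zero => simp [mY_zero]
  | succ k ih => rw [pow_succ, map_mul, ih, psi_wY, mY_succ]; push_cast; rfl

theorem mZ_zero : mZ 0 = 1 := by decide

theorem mZ_succ (k : ℤ) : mZ k * mZ 1 = mZ (k + 1) := by
  ext i j
  fin_cases i <;> fin_cases j <;>
    simp [mZ, Matrix.mul_apply, Fin.sum_univ_succ] <;> ring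

theorem psi_wZ_pow (k : ℕ) : psi (wZ ^ k) = mZ k := by
  induction k with
  | zero => simp [mZ_zero]
  | succ k ih => rw [pow_succ, map_mul, ih, psi_wZ, mZ_succ]; push_cast; rfl

def wI (p b c q : ℕ) : B7 := wX ^ p * wB * wY ^ b * wC * wZ ^ c * wA * wX ^ q

theorem ent_I (p b c q : ℕ) :
    psi (wI p b c q) 1 1 = -1 - q ∧
    psi (wI p b c q) 3 3 = -1 - p ∧
    psi (wI p b c q) 5 5 = -1 - b - p ∧
    psi (wI p b c q) 0 0 = -1 - b - c - p ∧
    psi (wI p b c q) 1 3 = 0 ∧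
    psi (wI p b c q) 3 1 = -1 - q := by
  simp only [wI, map_mul, psi_wX_pow, psi_wY_pow, psi_wZ_pow, psi_wA, psi_wB, psi_wC]
  simp only [Matrix.mul_apply_eq_vecMul, mA, mB, mC, mX, mY, mZ]
  refine ⟨?_, ?_, ?_, ?_, ?_, ?_⟩ <;>
    simp [Matrix.vecMul, dotProduct, Fin.sum_univ_succ] <;> ring

def wJ (p c a q : ℕ) : B7 := wY ^ p * wC * wZ ^ c * wA * wX ^ a * wB * wY ^ q

theorem ent_J (p c a q : ℕ) :
    psi (wJ p c a q) 1 3 = 1 + q ∧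
    psi (wJ p c a q) 4 4 = -1 - p ∧
    psi (wJ p c a q) 1 1 = -3 - a - 2*q ∧
    psi (wJ p c a q) 0 0 = -c - p ∧
    psi (wJ p c a q) 3 1 = -2 - a - q := by
  simp only [wJ, map_mul, psi_wX_pow, psi_wY_pow, psi_wZ_pow, psi_wA, psi_wB, psi_wC]
  simp only [Matrix.mul_apply_eq_vecMul, mA, mB, mC, mX, mY, mZ]
  refine ⟨?_, ?_, ?_, ?_, ?_⟩ <;>
    simp [Matrix.vecMul, dotProduct, Fin.sum_univ_succ] <;> ring

def wK (p a b q : ℕ) : B7 := wZ ^ p * wA * wX ^ a * wB * wY ^ b * wC * wZ ^ q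

theorem ent_K (p a b q : ℕ) :
    psi (wK p a b q) 1 1 = -1 - p ∧
    psi (wK p a b q) 4 4 = -2 - q ∧
    psi (wK p a b q) 2 2 = -1 - b - q ∧
    psi (wK p a b q) 0 0 = -1 - a - b - q ∧
    psi (wK p a b q) 1 3 = 1 + p ∧
    psi (wK p a b q) 3 1 = 0 := by
  simp only [wK, map_mul, psi_wX_pow, psi_wY_pow, psi_wZ_pow, psi_wA, psi_wB, psi_wC]
  simp only [Matrix.mul_apply_eq_vecMul, mA, mB, mC, mX, mY, mZ]
  refine ⟨?_, ?_, ?_, ?_, ?_, ?_⟩ <;>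
    simp [Matrix.vecMul, dotProduct, Fin.sum_univ_succ] <;> ring

theorem wI_inj {p b c q p' b' c' q' : ℕ} (h : wI p b c q = wI p' b' c' q') :
    p = p' ∧ b = b' ∧ c = c' ∧ q = q' := by
  have h1 := ent_I p b c q
  have h2 := ent_I p' b' c' q'
  rw [h] at h1
  omega

theorem wJ_inj {p c a q p' c' a' q' : ℕ} (h : wJ p c a q = wJ p' c' a' q') :
    p = p' ∧ c = c' ∧ a = a' ∧ q = q' := by
  have h1 := ent_J p c a q
  have h2 := ent_J p' c' a' q'
  rw [h] at h1
  omega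

theorem wK_inj {p a b q p' a' b' q' : ℕ} (h : wK p a b q = wK p' a' b' q') :
    p = p' ∧ a = a' ∧ b = b' ∧ q = q' := by
  have h1 := ent_K p a b q
  have h2 := ent_K p' a' b' q'
  rw [h] at h1
  omega

theorem wI_ne_wJ {p b c q p' c' a' q' : ℕ} : wI p b c q ≠ wJ p' c' a' q' := by
  intro h
  have h1 := ent_I p b c q
  have h2 := ent_J p' c' a' q'
  rw [h] at h1
  omega

theorem wI_ne_wK {p b c q p' a' b' q' : ℕ} : wI p b c q ≠ wK p' a' b' q' := by
  intro h
  have h1 := ent_I p b c q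
  have h2 := ent_K p' a' b' q'
  rw [h] at h1
  omega

theorem wJ_ne_wK {p c a q p' a' b' q' : ℕ} : wJ p c a q ≠ wK p' a' b' q' := by
  intro h
  have h1 := ent_J p c a q
  have h2 := ent_K p' a' b' q'
  rw [h] at h1
  omega

theorem F_eq (a b c : ℕ) : F a b c = [wA] ++ List.replicate a wX ++ [wB] ++
    List.replicate b wY ++ [wC] ++ List.replicate c wZ := rfl

theorem rot_I (p b c q : ℕ) : ((F (q + p) b c).rotate (q + 1)).prod = wI p b c q := by
  have : F (q + p) b c = ([wA] ++ List.replicate q wX) ++ (List.replicate p wX ++ [wB] ++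
    List.replicate b wY ++ [wC] ++ List.replicate c wZ) := by
    rw [F_eq, List.replicate_add]; simp only [List.append_assoc]
  have hl : ([wA] ++ List.replicate q wX).length = q + 1 := by simp; try omega
  rw [this, ← hl, List.rotate_append_length_eq]
  simp [wI, mul_assoc]

theorem rot_J (p c a q : ℕ) : ((F a (q + p) c).rotate (a + q + 2)).prod = wJ p c a q := by
  have : F a (q + p) c = ([wA] ++ List.replicate a wX ++ [wB] ++ List.replicate q wY) ++
      (List.replicate p wY ++ [wC] ++ List.replicate c wZ) := by
    rw [F_eq, List.replicate_add]; simp only [List.append_assoc]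
  have hl : ([wA] ++ List.replicate a wX ++ [wB] ++ List.replicate q wY).length = a + q + 2 := by
    simp; try omega
  rw [this, ← hl, List.rotate_append_length_eq]
  simp [wJ, mul_assoc]

theorem rot_K (p a b q : ℕ) : ((F a b (q + p)).rotate (a + b + q + 3)).prod = wK p a b q := by
  have : F a b (q + p) = ([wA] ++ List.replicate a wX ++ [wB] ++ List.replicate b wY ++ [wC] ++
      List.replicate q wZ) ++ List.replicate p wZ := by
    rw [F_eq, List.replicate_add]; simp only [List.append_assoc]
  have hl : ([wA] ++ List.replicate a wX ++ [wB] ++ List.replicate b wY ++ [wC] ++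
      List.replicate q wZ).length = a + b + q + 3 := by
    simp; try omega
  rw [this, ← hl, List.rotate_append_length_eq]
  simp [wK, mul_assoc]

theorem F_len (a b c : ℕ) : (F a b c).length = a + b + c + 3 := by
  simp [F_eq]; omega

/-- quadruples (m, k, x, y) with x + y = k ≤ m ≤ n -/
def E3 (n : ℕ) : Finset (Σ _ : ℕ, ℕ × ℕ) :=
  (Finset.range (n + 1)).sigma fun k => Finset.HasAntidiagonal.antidiagonal k

def E4 (n : ℕ) : Finset (Σ _ : ℕ, Σ _ : ℕ, ℕ × ℕ) :=
  (Finset.range (n + 1)).sigma fun m => E3 m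

theorem E3_card (n : ℕ) : 2 * (E3 n).card = (n + 1) * (n + 2) := by
  rw [E3, Finset.card_sigma]
  induction n with
  | zero => simp
  | succ n ih => rw [Finset.sum_range_succ, mul_add, ih, Finset.Nat.card_antidiagonal]; ring

theorem E4_card (n : ℕ) : 6 * (E4 n).card = (n + 1) * (n + 2) * (n + 3) := by
  rw [E4, Finset.card_sigma]
  induction n with
  | zero => simp [E3]
  | succ n ih =>
    rw [Finset.sum_range_succ, mul_add, ih]
    have := E3_card (n + 1)
    linear_combination 3 * this

theorem mem_E4 {n m k x y : ℕ} :
    (⟨m, k, x, y⟩ : Σ _ : ℕ, Σ _ : ℕ, ℕ × ℕ) ∈ E4 n ↔ m ≤ n ∧ k ≤ m ∧ x + y = k := by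
  simp [E4, E3, Finset.mem_sigma, Nat.lt_succ_iff]

def fmap (n : ℕ) (t : Fin 3 × (Σ _ : ℕ, Σ _ : ℕ, ℕ × ℕ)) : B7 :=
  match t with
  | (0, ⟨m, k, x, y⟩) => wI (n - m) (m - k) x y
  | (1, ⟨m, k, x, y⟩) => wJ (n - m) (m - k) x y
  | (2, ⟨m, k, x, y⟩) => wK (n - m) (m - k) x y

theorem fmap_inj (n : ℕ) :
    Set.InjOn (fmap n) (((Finset.univ : Finset (Fin 3)) ×ˢ E4 n : Finset _) : Set _) := by
  rintro ⟨t, m, k, x, y⟩ h ⟨t', m', k', x', y'⟩ h' he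
  rw [Finset.mem_coe, Finset.mem_product] at h h'
  have h1 := mem_E4.1 h.2
  have h2 := mem_E4.1 h'.2
  have fin : ∀ t : Fin 3, m = m' ∧ k = k' ∧ x = x' ∧ y = y' →
      ((t, ⟨m, k, x, y⟩) : Fin 3 × (Σ _ : ℕ, Σ _ : ℕ, ℕ × ℕ)) = (t, ⟨m', k', x', y'⟩) := by
    rintro t ⟨rfl, rfl, rfl, rfl⟩; rfl
  clear h h'
  fin_cases t <;> fin_cases t' <;> simp only [fmap] at he
  · have := wI_inj he; exact fin _ (by omega)
  · exact absurd he wI_ne_wJ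
  · exact absurd he wI_ne_wK
  · exact absurd he.symm wI_ne_wJ
  · have := wJ_inj he; exact fin _ (by omega)
  · exact absurd he wJ_ne_wK
  · exact absurd he.symm wI_ne_wK
  · exact absurd he.symm wJ_ne_wK
  · have := wK_inj he; exact fin _ (by omega)

/-- For every `L ≥ 3`, the set of all products of rotations of the factor lists
`F(a,b,c)` with `a + b + c = L - 3` has at least `L·(L−1)·(L−2)/2` elements. -/
theorem card_rotated_products (L : ℕ) (hL : 3 ≤ L) :
    L * (L - 1) * (L - 2) / 2 ≤
      Set.ncard {x : B7 | ∃ a b c i : ℕ, a + b + c = L - 3 ∧ i < L ∧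
        x = ((F a b c).rotate i).prod} := by
  classical
  obtain ⟨n, rfl⟩ : ∃ n, L = n + 3 := ⟨L - 3, by omega⟩
  have hfin : Set.Finite {x : B7 | ∃ a b c i : ℕ, a + b + c = n + 3 - 3 ∧ i < n + 3 ∧
        x = ((F a b c).rotate i).prod} := by
    let R := Finset.range (n + 3)
    refine ((R ×ˢ R ×ˢ R ×ˢ R).image
      (fun t : ℕ × ℕ × ℕ × ℕ => ((F t.1 t.2.1 t.2.2.1).rotate t.2.2.2).prod)).finite_toSet.subset ?_
    rintro x ⟨a, b, c, i, h, hi, rfl⟩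
    simp only [Finset.coe_image, Set.mem_image, Finset.mem_coe]
    refine ⟨(a, b, c, i), ?_, rfl⟩
    simp only [Finset.mem_product, R, Finset.mem_range]
    omega
  have hsub : ((((Finset.univ : Finset (Fin 3)) ×ˢ E4 n).image (fmap n) : Finset B7) : Set B7) ⊆
      {x : B7 | ∃ a b c i : ℕ, a + b + c = n + 3 - 3 ∧ i < n + 3 ∧
        x = ((F a b c).rotate i).prod} := by
    intro x hx
    simp only [Finset.coe_image, Set.mem_image, Finset.mem_coe, Finset.mem_product] at hx
    obtain ⟨⟨t, m, k, x, y⟩, ⟨-, h⟩, rfl⟩ := hx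
    have h := mem_E4.1 h
    fin_cases t
    · exact ⟨y + (n - m), m - k, x, y + 1, by omega, by omega, (rot_I _ _ _ _).symm⟩
    · exact ⟨x, y + (n - m), m - k, x + y + 2, by omega, by omega, (rot_J _ _ _ _).symm⟩
    · refine ⟨m - k, x, y + (n - m), (m - k + x + y + 3) % (n + 3), by omega,
        Nat.mod_lt _ (by omega), ?_⟩
      have hl : n + 3 = (F (m - k) x (y + (n - m))).length := by rw [F_len]; omega
      rw [hl, List.rotate_mod]
      exact (rot_K _ _ _ _).symm
  have hc := Set.ncard_le_ncard hsub hfin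
  rw [Set.ncard_coe_finset, Finset.card_image_of_injOn (fmap_inj n), Finset.card_product] at hc
  refine le_trans ?_ hc
  have h4 := E4_card n
  have e : (n + 3) * (n + 3 - 1) * (n + 3 - 2) = 6 * (E4 n).card := by
    rw [h4, show n + 3 - 1 = n + 2 by omega, show n + 3 - 2 = n + 1 by omega]; ring
  rw [e, Finset.card_univ, Fintype.card_fin]
  omega
end

section
/- For every odd integer N ≥ 5 and every integer L ≥ 2, the braid β(N,L) = (σ1σ3σ5⋯σ_{N−2})^{L+1}·(σ1σ2σ3⋯σ_{N−1}) is not a proper power in the braid group B_N: if y ∈ B_N and k ≥ 1 satisfy y^k = β(N,L), then k = 1. -/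
/-- The braid group `B_N`, presented with generators `σ_1, …, σ_{N-1}` and the
Artin relations. -/
abbrev BraidGroup (N : ℕ) : Type := PresentedGroup (braidRels (N - 1))

/-- The Artin generator `σ_{i+1}` of `B_N`. -/
def braidGen (N : ℕ) (i : Fin (N - 1)) : BraidGroup N := PresentedGroup.of i

/-- The product `σ1σ3σ5⋯σ_{N-2}` of the odd-indexed generators of `B_N`
(for odd `N`), in increasing order. -/
def oddGensProd (N : ℕ) : BraidGroup N :=
  (((List.finRange (N - 1)).filter (fun (i : Fin (N - 1)) => (i : ℕ) % 2 == 0)).map (braidGen N)).prod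

/-- The product `σ1σ2σ3⋯σ_{N-1}` of all generators of `B_N` in increasing order. -/
def allGensProd (N : ℕ) : BraidGroup N :=
  ((List.finRange (N - 1)).map (braidGen N)).prod

/-- The braid `β(N,L) = (σ1σ3σ5⋯σ_{N−2})^{L+1}·(σ1σ2σ3⋯σ_{N−1}) ∈ B_N`. -/
def betaBraid (N L : ℕ) : BraidGroup N := (oddGensProd N) ^ (L + 1) * allGensProd N


section Burau
variable {R : Type*} [CommRing R] (N : ℕ) (t : R)

def bU (i : ℕ) : Fin N → R := fun a => if a.val = i then -t else if a.val = i + 1 then 1 else 0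
def bV (i : ℕ) : Fin N → R := fun a => if a.val = i then 1 else if a.val = i + 1 then -1 else 0
def bE (i : ℕ) : Matrix (Fin N) (Fin N) R := Matrix.vecMulVec (bU N t i) (bV N i)

lemma bV_dot (i : ℕ) (h : i + 1 < N) (w : Fin N → R) :
    bV N i ⬝ᵥ w = w ⟨i, by omega⟩ - w ⟨i + 1, h⟩ := by
  have : ∀ b : Fin N, bV N i b * w b = (if b = ⟨i, by omega⟩ then w b else 0)
      - (if b = ⟨i+1, h⟩ then w b else 0) := by
    intro b
    simp only [bV, Fin.ext_iff]
    split_ifs <;> first | omega | simp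
  simp only [dotProduct, this, Finset.sum_sub_distrib]
  simp

lemma dot_bU (i : ℕ) (h : i + 1 < N) (w : Fin N → R) :
    w ⬝ᵥ bU N t i = -t * w ⟨i, by omega⟩ + w ⟨i + 1, h⟩ := by
  have : ∀ b : Fin N, w b * bU N t i b = (if b = ⟨i, by omega⟩ then -t * w b else 0)
      + (if b = ⟨i+1, h⟩ then w b else 0) := by
    intro b
    simp only [bU, Fin.ext_iff]
    split_ifs <;> first | omega | simp [mul_comm]
  simp only [dotProduct, this, Finset.sum_add_distrib]
  simp

lemma bE_mul (i j : ℕ) : bE N t i * bE N t j =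
    (bV N i ⬝ᵥ bU N t j) • Matrix.vecMulVec (bU N t i) (bV N j) := by
  simp [bE, Matrix.vecMulVec_mul_vecMulVec]

lemma bE_sq (i : ℕ) (h : i + 1 < N) : bE N t i * bE N t i = (-(1 + t)) • bE N t i := by
  rw [bE_mul, bV_dot N i h]; simp [bE, bU]; ring_nf

lemma bE_far (i j : ℕ) (h : i + 1 < N) (hij : i + 2 ≤ j ∨ j + 2 ≤ i) :
    bE N t i * bE N t j = 0 := by
  rw [bE_mul, bV_dot N i h]; simp only [bU]
  split_ifs <;> first | omega | simp

lemma bE_near (i : ℕ) (h : i + 2 < N) :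
    bE N t i * bE N t (i+1) * bE N t i = t • bE N t i := by
  rw [bE_mul, Matrix.smul_mul, bE, Matrix.vecMulVec_mul_vecMulVec, bV_dot N i (by omega), bV_dot N (i+1) h]
  simp [bU, show ¬ i = i + 1 + 1 by omega, show ¬ i + 1 + 1 = i by omega]

lemma bE_near' (i : ℕ) (h : i + 2 < N) :
    bE N t (i+1) * bE N t i * bE N t (i+1) = t • bE N t (i+1) := by
  rw [bE_mul, Matrix.smul_mul, bE, Matrix.vecMulVec_mul_vecMulVec, bV_dot N i (by omega), bV_dot N (i+1) h]
  simp [bU, show ¬ i = i + 1 + 1 by omega, show ¬ i + 1 + 1 = i by omega]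

lemma braid_near (i : ℕ) (h : i + 2 < N) :
    (1 + bE N t i) * (1 + bE N t (i+1)) * (1 + bE N t i)
     = (1 + bE N t (i+1)) * (1 + bE N t i) * (1 + bE N t (i+1)) := by
  have h1 := bE_near N t i h
  have h2 := bE_near' N t i h
  have h3 := bE_sq N t i (by omega)
  have h4 := bE_sq N t (i+1) (by omega)
  simp only [mul_add, add_mul, mul_one, one_mul, h1, h2, h3, h4]
  module

def bUnit (s : Rˣ) (i : ℕ) (h : i + 1 < N) : (Matrix (Fin N) (Fin N) R)ˣ where
  val := 1 + bE N (s : R) i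
  inv := 1 + (↑s⁻¹ : R) • bE N (s : R) i
  val_inv := by
    have h3 := bE_sq N (s : R) i h
    simp only [mul_add, add_mul, mul_one, one_mul, Matrix.mul_smul, h3, smul_smul]
    have : (↑s⁻¹ : R) * (-(1 + (s : R))) = -(↑s⁻¹ : R) - 1 := by
      have := s.inv_mul
      linear_combination -this
    rw [this]; module
  inv_val := by
    have h3 := bE_sq N (s : R) i h
    simp only [mul_add, add_mul, mul_one, one_mul, Matrix.smul_mul, h3, smul_smul]
    have : (↑s⁻¹ : R) * (-(1 + (s : R))) = -(↑s⁻¹ : R) - 1 := by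
      have := s.inv_mul
      linear_combination -this
    rw [this]; module

def burau (s : Rˣ) : BraidGroup N →* (Matrix (Fin N) (Fin N) R)ˣ :=
  PresentedGroup.toGroup (f := fun i : Fin (N-1) => bUnit N s i.val (by omega)) (by
    rintro r ⟨⟨i, hi⟩, ⟨j, hj⟩, ⟨h, rfl⟩ | ⟨h, rfl⟩⟩
    · simp only at h
      subst h
      simp only [map_mul, map_inv, FreeGroup.lift_apply_of]
      rw [mul_inv_eq_one]
      ext1
      exact braid_near N (s : R) i (by omega)
    · simp only at h
      simp only [map_mul, map_inv, FreeGroup.lift_apply_of]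
      rw [mul_inv_eq_one]
      ext1
      simp only [bUnit, Units.val_mul]
      have h1 := bE_far N (s : R) i j (by omega) (by omega)
      have h2 := bE_far N (s : R) j i (by omega) (by omega)
      simp only [mul_add, add_mul, mul_one, one_mul, h1, h2]
      abel)

lemma burau_gen (s : Rˣ) (i : Fin (N-1)) :
    ((burau N s (braidGen N i) : (Matrix (Fin N) (Fin N) R)ˣ) : Matrix (Fin N) (Fin N) R)
      = 1 + bE N (s : R) i.val := by
  simp [burau, braidGen, bUnit]

lemma burau_list (s : Rˣ) (l : List (Fin (N-1))) :
    ((burau N s (l.map (braidGen N)).prod : (Matrix (Fin N) (Fin N) R)ˣ) : Matrix (Fin N) (Fin N) R)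
      = ((l.map Fin.val).map (fun i => 1 + bE N (s : R) i)).prod := by
  induction l with
  | nil => simp
  | cons a l ih => simp only [List.map_cons, List.prod_cons, map_mul, Units.val_mul, ih, burau_gen]

lemma burau_all (s : Rˣ) :
    ((burau N s (allGensProd N) : (Matrix (Fin N) (Fin N) R)ˣ) : Matrix (Fin N) (Fin N) R)
      = ((List.range (N-1)).map (fun i => 1 + bE N (s : R) i)).prod := by
  rw [allGensProd, burau_list]; simp

lemma burau_odd (s : Rˣ) :
    ((burau N s (oddGensProd N) : (Matrix (Fin N) (Fin N) R)ˣ) : Matrix (Fin N) (Fin N) R)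
      = (((List.range (N-1)).filter (fun i => i % 2 == 0)).map (fun i => 1 + bE N (s : R) i)).prod := by
  rw [oddGensProd, burau_list]
  congr 2
  rw [← List.map_coe_finRange_eq_range, List.filter_map]
  rfl

lemma odd_prod (m : ℕ) (h : 2 * m + 1 ≤ N) :
    (((List.range (2*m)).filter (fun i => i % 2 == 0)).map (fun i => 1 + bE N t i)).prod
     = 1 + ∑ j ∈ Finset.range m, bE N t (2*j) := by
  induction m with
  | zero => simp
  | succ m ih =>
    rw [show 2 * (m+1) = 2*m+1+1 by ring, List.range_succ, List.range_succ]
    simp only [List.filter_append, List.map_append, List.prod_append, ih (by omega)]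
    have e1 : List.filter (fun i => i % 2 == 0) [2*m] = [2*m] := by simp
    have e2 : List.filter (fun i => i % 2 == 0) [2*m+1] = [] := by simp
    rw [e1, e2, Finset.sum_range_succ]
    have : (∑ j ∈ Finset.range m, bE N t (2*j)) * bE N t (2*m) = 0 := by
      rw [Finset.sum_mul]
      refine Finset.sum_eq_zero fun j hj => ?_
      have := Finset.mem_range.1 hj
      exact bE_far N t _ _ (by omega) (by omega)
    simp [mul_add, add_mul, this]
    abel

lemma S_sq (m : ℕ) (h : 2 * m + 1 ≤ N) :
    (∑ j ∈ Finset.range m, bE N t (2*j)) * (∑ j ∈ Finset.range m, bE N t (2*j))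
     = (-(1 + t)) • ∑ j ∈ Finset.range m, bE N t (2*j) := by
  rw [Finset.sum_mul, Finset.smul_sum]
  refine Finset.sum_congr rfl fun j hj => ?_
  have hj' := Finset.mem_range.1 hj
  rw [Finset.mul_sum, Finset.sum_eq_single j]
  · exact bE_sq N t _ (by omega)
  · intro b hb hbj
    exact bE_far N t _ _ (by omega) (by omega)
  · simp [hj']

lemma pow_S {A : Type*} [Ring A] [Algebra R A] (S : A) (hS : S * S = (-(1+t)) • S) (n : ℕ) :
    (1 + S)^n = 1 + (∑ j ∈ Finset.range n, (-t)^j) • S := by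
  induction n with
  | zero => simp
  | succ n ih =>
    rw [pow_succ', ih, geom_sum_succ]
    simp only [mul_add, add_mul, mul_one, one_mul, mul_smul_comm, hS]
    module

lemma all_prod (k : ℕ) (h : k < N) (a b : Fin N) :
    ((List.range k).map (fun i => 1 + bE N t i)).prod a b
     = if a.val = 0 then (if b.val < k then t^b.val * (1-t) else if b.val = k then t^k else 0)
       else if a.val ≤ k then (if b.val + 1 = a.val then 1 else 0)
       else if b.val = a.val then 1 else 0 := by
  induction k generalizing b with
  | zero =>
    simp only [List.range_zero, List.map_nil, List.prod_nil, Matrix.one_apply, Fin.ext_iff]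
    split_ifs <;> first | omega | simp
  | succ k ih =>
    rw [List.range_succ, List.map_append, List.prod_append]
    simp only [List.map_cons, List.map_nil, List.prod_cons, List.prod_nil, mul_one, mul_add]
    set M := ((List.range k).map (fun i => 1 + bE N t i)).prod with hM
    have e : (M * bE N t k) a b = (M a ⬝ᵥ bU N t k) * bV N k b := by
      simp only [bE, Matrix.mul_apply, Matrix.vecMulVec_apply, dotProduct, Finset.sum_mul, mul_assoc]
    rw [Matrix.add_apply, e, dot_bU N t k h]
    simp only [ih (by omega), bV]
    by_cases h0 : a.val = 0
    · simp only [h0, if_true]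
      rcases lt_trichotomy b.val k with hb | hb | hb
      · simp [hb, hb.ne, show b.val ≠ k+1 by omega, show b.val < k + 1 by omega]
      · simp [hb]; ring
      · by_cases hb2 : b.val = k+1
        · simp [hb2]; ring
        · simp [hb2, show ¬ b.val < k by omega, show ¬ b.val = k by omega, show ¬ b.val < k+1 by omega]
    · simp only [h0, if_false]
      split_ifs <;> first | omega | simp

lemma trace_bE (M : Matrix (Fin N) (Fin N) R) (i : ℕ) (h : i + 1 < N) :
    (bE N t i * M).trace = -t * (M ⟨i, by omega⟩ ⟨i, by omega⟩ - M ⟨i+1, h⟩ ⟨i, by omega⟩)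
      + (M ⟨i, by omega⟩ ⟨i+1, h⟩ - M ⟨i+1, h⟩ ⟨i+1, h⟩) := by
  rw [bE, Matrix.vecMulVec_mul, Matrix.trace_vecMulVec, dotProduct_comm, dot_bU N t i h]
  simp only [Matrix.vecMul, bV_dot N i h]

lemma trace_beta (s : Rˣ) (m L : ℕ) (hm : 1 ≤ m) :
    ((burau (2*m+1) s (betaBraid (2*m+1) L) : (Matrix _ _ R)ˣ) : Matrix (Fin (2*m+1)) _ R).trace
     = 1 - (s : R) + (∑ j ∈ Finset.range (L+1), (-(s : R))^j) * (m * (s : R)) := by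
  rw [betaBraid, map_mul, map_pow, Units.val_mul, Units.val_pow_eq_pow_val, burau_all, burau_odd]
  simp only [Nat.add_sub_cancel]
  rw [odd_prod _ _ m le_rfl, pow_S _ _ (S_sq _ _ m le_rfl), add_mul, one_mul, Matrix.trace_add,
    smul_mul_assoc, Matrix.trace_smul, Finset.sum_mul, Matrix.trace_sum]
  congr 1
  · rw [Matrix.trace, Fin.sum_univ_succ, Finset.sum_eq_zero]
    · rw [Matrix.diag_apply, all_prod _ _ _ (by omega)]
      simp [show 0 < m by omega]
    · intro i _
      rw [Matrix.diag_apply, all_prod _ _ _ (by omega)]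
      have := i.2
      simp only [Fin.val_succ]
      split_ifs <;> first | omega | contradiction | rfl
  · rw [smul_eq_mul]
    congr 1
    rw [Finset.sum_eq_card_nsmul (b := (s : R))]
    · simp
    · intro j hj
      have hj' := Finset.mem_range.1 hj
      rw [trace_bE _ _ _ _ (by omega)]
      simp only [all_prod _ _ (2*m) (show 2*m < 2*m+1 by omega)]
      rcases Nat.eq_zero_or_pos j with rfl | h0
      · simp [show 0 < m by omega, show 1 < 2*m by omega, show 1 ≤ 2*m by omega]; ring
      · simp [h0.ne', show 2*j ≤ 2*m by omega, show 2*j+1 ≤ 2*m by omega]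
        try omega

end Burau

lemma trace_pow_char' {R : Type*} [CommRing R] {n : Type*} [Fintype n] [DecidableEq n] (p : ℕ) [Fact p.Prime] [CharP R p]
    (A : Matrix n n R) : (A^p).trace = A.trace^p := by
  have hp : p.Prime := Fact.out
  rcases isEmpty_or_nonempty n with hn | hn
  · simp [Matrix.trace, hp.ne_zero]
  have : CharP (Matrix n n (Polynomial R)) p := inferInstance
  have h1 : A.charpolyRev ^ p = Polynomial.expand R p (A^p).charpolyRev := by
    rw [Matrix.charpolyRev, ← Matrix.det_pow, sub_pow_char_of_commute _ (Commute.one_left _)]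
    rw [Matrix.charpolyRev, AlgHom.map_det]
    congr 1
    rw [smul_pow, one_pow, map_sub, map_one]
    congr 1
    ext1 i j
    simp only [AlgHom.mapMatrix_apply, Matrix.map_apply, Matrix.smul_apply, smul_eq_mul, map_mul, Polynomial.expand_X, Polynomial.expand_C]
    rw [← Matrix.map_pow]
    rfl
  have h2 := congrArg (fun f => Polynomial.coeff f p) h1
  have h3 : A.charpolyRev ^ p = Polynomial.expand R p (A.charpolyRev.map (frobenius R p)) := by
    rw [← Polynomial.map_expand, Polynomial.map_frobenius_expand]
  simp only [h3] at h2
  have e : ∀ f : Polynomial R, (Polynomial.expand R p f).coeff p = f.coeff 1 := fun f => by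
    have := Polynomial.coeff_expand_mul hp.pos f 1
    simpa using this
  rw [e, e, Polynomial.coeff_map, Matrix.coeff_charpolyRev_eq_neg_trace, Matrix.coeff_charpolyRev_eq_neg_trace, map_neg, neg_inj] at h2
  exact h2.symm

lemma laurent_pth (p : ℕ) [Fact p.Prime] (f : LaurentPolynomial (ZMod p)) (g : Polynomial (ZMod p))
    (h : f^p = Polynomial.toLaurent g) (i : ℕ) (hi : ¬ p ∣ i) : g.coeff i = 0 := by
  obtain ⟨n, f', hf⟩ := LaurentPolynomial.exists_T_pow f
  have h1 : Polynomial.toLaurent (f'^p) = Polynomial.toLaurent (g * Polynomial.X^(n*p)) := by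
    rw [map_pow, hf, mul_pow, h, map_mul, Polynomial.toLaurent_X_pow, LaurentPolynomial.T_pow]
    push_cast; ring_nf
  have h2 := Polynomial.toLaurent_injective h1
  have h3 := congrArg (fun f => Polynomial.coeff f (i + n*p)) h2
  simp only [Polynomial.coeff_mul_X_pow] at h3
  rw [← h3, ← ZMod.expand_card, Polynomial.coeff_expand (Fact.out : p.Prime).pos, if_neg]
  rwa [Nat.dvd_add_left (Dvd.intro_left _ rfl)]

/-- For every odd `N ≥ 5` and every `L ≥ 2`, the braid `β(N,L)` is not a proper
power in `B_N`. -/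
theorem betaBraid_not_proper_power (N L : ℕ) (hN : Odd N) (hN5 : 5 ≤ N) (hL : 2 ≤ L)
    (y : BraidGroup N) (k : ℕ) (hk : 1 ≤ k) (hyk : y ^ k = betaBraid N L) :
    k = 1 := by
  by_contra hk1
  obtain ⟨p, hp, q, rfl⟩ := Nat.exists_prime_and_dvd hk1
  have : Fact p.Prime := ⟨hp⟩
  obtain ⟨m, rfl⟩ := hN
  obtain ⟨l, rfl⟩ := Nat.exists_eq_add_of_le' hL
  let s : (LaurentPolynomial (ZMod p))ˣ :=
    ⟨LaurentPolynomial.T 1, LaurentPolynomial.T (-1), by rw [← LaurentPolynomial.T_add]; simp,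
      by rw [← LaurentPolynomial.T_add]; simp⟩
  have hs : (s : LaurentPolynomial (ZMod p)) = Polynomial.toLaurent Polynomial.X := by
    simp [s, Polynomial.toLaurent_X]
  have h1 := trace_beta s m (l+2) (by omega)
  have : CharP (LaurentPolynomial (ZMod p)) p :=
    charP_of_injective_algebraMap (algebraMap (ZMod p) (LaurentPolynomial (ZMod p))).injective p
  rw [← hyk, mul_comm p q, pow_mul, map_pow, Units.val_pow_eq_pow_val, trace_pow_char', hs] at h1
  have h2 : ∀ i, ¬ p ∣ i → _ := laurent_pth p _ (1 - Polynomial.X + (∑ j ∈ Finset.range (l+2+1),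
    (-Polynomial.X)^j) * ((m : Polynomial (ZMod p)) * Polynomial.X)) (h1.trans (by simp))
  have hX : ∀ j : ℕ, (-(Polynomial.X : Polynomial (ZMod p)))^j = Polynomial.C ((-1)^j) * Polynomial.X^j := by
    intro j; rw [neg_pow]; simp
  have h3 : ∀ i, i < l + 3 → (∑ j ∈ Finset.range (l+2+1), (-(Polynomial.X : Polynomial (ZMod p)))^j).coeff i = (-1)^i := by
    intro i hi
    rw [Polynomial.finsetSum_coeff, Finset.sum_eq_single i]
    · rw [hX, Polynomial.coeff_C_mul_X_pow, if_pos rfl]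
    · intro b _ hb
      rw [hX, Polynomial.coeff_C_mul_X_pow, if_neg hb.symm]
    · intro h; simp at h; omega
  have h4 : ∀ i, i < l + 3 → ¬ p ∣ i + 1 → (if i = 0 then (-1 : ZMod p) else 0) + (-1)^i * m = 0 := by
    intro i hi hpi
    have := h2 (i+1) hpi
    rw [← mul_assoc, Polynomial.coeff_add, Polynomial.coeff_mul_X, ← Polynomial.C_eq_natCast, Polynomial.coeff_mul_C, h3 i hi] at this
    refine Eq.trans ?_ this
    congr 1
    simp [Polynomial.coeff_one, Polynomial.coeff_X]
    split_ifs <;> first | omega | simp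
  have a0 := h4 0 (by omega) (by simpa using hp.one_lt.ne')
  have hm0 : (m : ZMod p) = 0 := by
    by_cases h : p = 2
    · have := h4 2 (by omega) (by subst h; decide)
      simpa using this
    · have := h4 1 (by omega) (fun hd => h ((Nat.prime_dvd_prime_iff_eq hp Nat.prime_two).1 hd))
      simpa using this
  simp [hm0] at a0
end
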